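/- Let A = (a₁,…,aₙ) and B = (b₁,…,b_m) be generalized quiddity sequences (of lengths n, m ≥ 2). Then for every k ∈ {1,…,n}, the tuple A ∘ₖ B is a generalized quiddity sequence of length n+m−1. -/

import Mathlib

/-- The 2×2 matrix `M(a) = [[a, -1], [1, 0]]`. -/
noncomputable def Mmat (a : ℂ) : Matrix (Fin 2) (Fin 2) ℂ := !![a, -1; 1, 0]

/-- A generalized quiddity sequence: a tuple `(a₁,…,aₙ)` with
`M(aₙ)·M(aₙ₋₁)···M(a₁) = -Id`. -/
def IsGQS (A : List ℂ) : Prop := (A.reverse.map Mmat).prod = -1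

/-- The partial composition `A ∘ₖ B`, with `1`-based index `k`.  For
`1 ≤ k ≤ n-1` (i.e. `k < A.length`) it is
`(a₁,…,a_{k−1}, a_k+b₁+1, b₂,…,b_{m−1}, b_m+1, a_{k+1}+1, a_{k+2},…,aₙ)`,
and for `k = n` it is `(a₁+1, a₂,…,a_{n−1}, aₙ+b₁+1, b₂,…,b_{m−1}, b_m+1)`. -/
noncomputable def qcomp (A B : List ℂ) (k : ℕ) : List ℂ :=
  if k < A.length then
    A.take (k - 1) ++ (A.getD (k - 1) 0 + B.getD 0 0 + 1) ::
      ((B.drop 1).dropLast ++ (B.getLastD 0 + 1) :: (A.getD k 0 + 1) :: A.drop (k + 1))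
  else
    (A.getD 0 0 + 1) :: ((A.drop 1).dropLast ++ (A.getLastD 0 + B.getD 0 0 + 1) ::
      ((B.drop 1).dropLast ++ [B.getLastD 0 + 1]))

theorem mul_eq_neg_one_symm {X Y : Matrix (Fin 2) (Fin 2) ℂ} (h : X * Y = -1) :
    Y * X = -1 := by
  have h1 : (-X) * Y = 1 := by rw [neg_mul, h, neg_neg]
  have h2 := mul_eq_one_comm.mp h1
  rw [mul_neg] at h2
  rw [← h2, neg_neg]

theorem Mmat_mul_inv (a : ℂ) : Mmat a * !![0, 1; -1, a] = 1 := by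
  ext i j; fin_cases i <;> fin_cases j <;> simp [Mmat]

theorem Mmat_inv_mul (a : ℂ) : !![0, 1; -1, a] * Mmat a = 1 :=
  mul_eq_one_comm.mp (Mmat_mul_inv a)

/-- Inserting the interior of a generalized quiddity sequence `(b, …, c)` between two
adjusted entries does not change the product of the two original matrices. -/
theorem Mmat_insert {b c : ℂ} {X : Matrix (Fin 2) (Fin 2) ℂ}
    (h : Mmat c * X * Mmat b = -1) (a a' : ℂ) :
    Mmat (a' + 1) * (Mmat (c + 1) * X * Mmat (a + b + 1)) = Mmat a' * Mmat a := by
  have hX : X = -(!![0, 1; -1, c] * !![0, 1; -1, b]) := by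
    calc X = (!![0, 1; -1, c] * Mmat c) * X * (Mmat b * !![0, 1; -1, b]) := by
          rw [Mmat_inv_mul, Mmat_mul_inv, one_mul, mul_one]
      _ = !![0, 1; -1, c] * (Mmat c * X * Mmat b) * !![0, 1; -1, b] := by
          simp only [mul_assoc]
      _ = _ := by rw [h, mul_neg_one, neg_mul]
  subst hX
  ext i j
  fin_cases i <;> fin_cases j <;> simp [Mmat] <;> ring

theorem exists_eq_cons_append_singleton {L : List ℂ} (h : 2 ≤ L.length) :
    ∃ (x : ℂ) (C : List ℂ) (y : ℂ), L = x :: (C ++ [y]) := by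
  obtain _ | ⟨x, T⟩ := L
  · simp at h
  · obtain rfl | ⟨C, y, rfl⟩ := List.eq_nil_or_concat' T
    · simp at h
    · exact ⟨x, C, y, rfl⟩

/-- If `A` and `B` are generalized quiddity sequences of lengths `n, m ≥ 2`, then
`A ∘ₖ B` is a generalized quiddity sequence of length `n+m−1`, for every
`k ∈ {1,…,n}`. -/
theorem gqs_closed_under_circ (n m : ℕ) (hn : 2 ≤ n) (hm : 2 ≤ m) (A B : List ℂ)
    (hA : A.length = n) (hB : B.length = m) (hAq : IsGQS A) (hBq : IsGQS B) :
    ∀ k, 1 ≤ k → k ≤ n →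
      IsGQS (qcomp A B k) ∧ (qcomp A B k).length = n + m - 1 := by
  intro k hk hkn
  subst hA hB
  obtain ⟨b, C, c, rfl⟩ := exists_eq_cons_append_singleton hm
  have hlast (x y : ℂ) (D : List ℂ) : (x :: (D ++ [y])).getLastD 0 = y := by
    rw [← List.cons_append, List.getLastD_concat]
  have hkey := @Mmat_insert b c (C.reverse.map Mmat).prod
    (by simpa [IsGQS, mul_assoc] using hBq)
  by_cases hlt : k < A.length
  · obtain ⟨j, rfl⟩ : ∃ j, k = j + 1 := ⟨k - 1, by omega⟩
    have hsplit : A = A.take j ++ A.getD j 0 :: A.getD (j + 1) 0 :: A.drop (j + 2) := by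
      rw [List.getD_eq_getElem _ _ (by omega), List.getD_eq_getElem _ _ hlt,
        List.getElem_cons_drop, List.getElem_cons_drop, List.take_append_drop]
    have hq : qcomp A (b :: (C ++ [c])) (j + 1) = A.take j ++ (A.getD j 0 + b + 1) ::
        (C ++ (c + 1) :: (A.getD (j + 1) 0 + 1) :: A.drop (j + 2)) := by
      rw [qcomp, if_pos hlt, hlast]
      simp
    rw [hq]
    refine ⟨?_, ?_⟩
    · rw [hsplit] at hAq
      generalize A.take j = S, A.getD j 0 = a, A.getD (j + 1) 0 = a', A.drop (j + 2) = T at *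
      simp only [IsGQS, List.reverse_append, List.reverse_cons, List.map_append,
        List.prod_append, List.map_cons, List.map_nil, List.prod_singleton] at hAq ⊢
      rw [← hAq]
      have := congrArg (fun Z => (T.reverse.map Mmat).prod * Z * (S.reverse.map Mmat).prod)
        (hkey a a')
      simpa only [mul_assoc] using this
    · simp
      omega
  · obtain ⟨a', D, a, rfl⟩ := exists_eq_cons_append_singleton hn
    have hq : qcomp (a' :: (D ++ [a])) (b :: (C ++ [c])) k = (a' + 1) :: (D ++ (a + b + 1) ::
        (C ++ [c + 1])) := by
      rw [qcomp, if_neg hlt, hlast, hlast]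
      simp
    rw [hq]
    refine ⟨?_, ?_⟩
    · simp only [IsGQS, List.reverse_append, List.reverse_cons, List.map_append,
        List.prod_append, List.map_cons, List.map_nil, List.prod_singleton,
        List.reverse_nil, List.nil_append] at hAq ⊢
      have h1 := mul_eq_neg_one_symm hAq
      rw [← mul_assoc, ← hkey a a', mul_assoc] at h1
      have h2 := mul_eq_neg_one_symm h1
      simpa only [mul_assoc] using h2
    · simp
      omega
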